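/- Let a : ℕ → ℂ be multiplicative and suppose the Dirichlet series f(s) = Σ_{n=1}^∞ a_n n^{-s} is somewhere convergent. If f extends to an analytic function on the half-plane {Re s > σ_0} that is bounded on {Re s ≥ σ_0 + ε} for every ε > 0, and f does not have such a bounded analytic extension past any smaller half-plane (i.e. σ_0 is the infimum of such abscissas), then σ_a(f) = σ_0. -/

import Mathlib

open Filter Topology

/-- `N`-th partial sum of the Dirichlet series `∑ a_n n^{-s}` at the point `s`. -/
noncomputable def dirichletPartial (a : ℕ → ℂ) (s : ℂ) (N : ℕ) : ℂ :=
  ∑ n ∈ Finset.range N, a (n + 1) / ((n : ℂ) + 1) ^ s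

/-- The Dirichlet series `∑ a_n n^{-σ}` converges (as a limit of partial sums). -/
def DirichletConvergesAt (a : ℕ → ℂ) (σ : ℝ) : Prop :=
  ∃ l : ℂ, Tendsto (dirichletPartial a (σ : ℂ)) atTop (𝓝 l)

/-- The series `∑ a_n n^{-σ - it}` converges uniformly in `t ∈ ℝ`. -/
def DirichletConvergesUniformlyAt (a : ℕ → ℂ) (σ : ℝ) : Prop :=
  ∃ g : ℝ → ℂ,
    TendstoUniformly (fun N (t : ℝ) => dirichletPartial a ((σ : ℂ) + (t : ℂ) * Complex.I) N) g atTop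

/-- The series `∑ |a_n| n^{-σ}` converges. -/
def DirichletAbsConvergesAt (a : ℕ → ℂ) (σ : ℝ) : Prop :=
  Summable fun n : ℕ => ‖a (n + 1)‖ / ((n : ℝ) + 1) ^ σ

/-- Abscissa of (simple) convergence. -/
noncomputable def sigmaC (a : ℕ → ℂ) : ℝ := sInf {σ : ℝ | DirichletConvergesAt a σ}

/-- Abscissa of uniform convergence. -/
noncomputable def sigmaB (a : ℕ → ℂ) : ℝ := sInf {σ : ℝ | DirichletConvergesUniformlyAt a σ}

/-- Abscissa of absolute convergence. -/
noncomputable def sigmaA (a : ℕ → ℂ) : ℝ := sInf {σ : ℝ | DirichletAbsConvergesAt a σ}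

/-- `a : ℕ → ℂ` is multiplicative: `a 1 = 1` and `a (m n) = a m * a n` for coprime `m, n ≥ 1`. -/
def IsMultiplicativeFun (a : ℕ → ℂ) : Prop :=
  a 1 = 1 ∧ ∀ m n : ℕ, 1 ≤ m → 1 ≤ n → Nat.Coprime m n → a (m * n) = a m * a n

/-- `a : ℕ → ℂ` is completely multiplicative. -/
def IsCompletelyMultiplicativeFun (a : ℕ → ℂ) : Prop :=
  a 1 = 1 ∧ ∀ m n : ℕ, 1 ≤ m → 1 ≤ n → a (m * n) = a m * a n

/-- `f` has an analytic continuation past `σ'`, agreeing with the (somewhere convergent)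
Dirichlet series on some half-plane, which is bounded on `{Re s ≥ σ' + ε}` for every
`ε > 0`. -/
def ExtendsBoundedlyPast (a : ℕ → ℂ) (σ' : ℝ) : Prop :=
  ∃ F : ℂ → ℂ,
    DifferentiableOn ℂ F {s : ℂ | σ' < s.re} ∧
    (∃ σ₁ : ℝ, σ' ≤ σ₁ ∧ ∀ s : ℂ, σ₁ < s.re →
      Tendsto (dirichletPartial a s) atTop (𝓝 (F s))) ∧
    ∀ ε : ℝ, 0 < ε → ∃ C : ℝ, ∀ s : ℂ, σ' + ε ≤ s.re → ‖F s‖ ≤ C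

/-- The mean value of `g` over `[0, T]`. -/
noncomputable def timeMean (g : ℝ → ℂ) (T : ℝ) : ℂ :=
  (T : ℂ)⁻¹ * ∫ t in (0 : ℝ)..T, g t

lemma timeMean_add {g h : ℝ → ℂ} (hg : Continuous g) (hh : Continuous h) (T : ℝ) :
    timeMean (fun t => g t + h t) T = timeMean g T + timeMean h T := by
  simp only [timeMean]
  rw [intervalIntegral.integral_add (hg.intervalIntegrable _ _) (hh.intervalIntegrable _ _),
    mul_add]

lemma timeMean_const_mul (c : ℂ) (g : ℝ → ℂ) (T : ℝ) :
    timeMean (fun t => c * g t) T = c * timeMean g T := by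
  simp only [timeMean, intervalIntegral.integral_const_mul]
  ring

lemma norm_timeMean_le {g : ℝ → ℂ} {C T : ℝ} (hT : 0 < T) (hg : ∀ t, ‖g t‖ ≤ C) :
    ‖timeMean g T‖ ≤ C := by
  have h := intervalIntegral.norm_integral_le_of_norm_le_const
    (a := 0) (b := T) (f := g) (C := C) fun t _ => hg t
  rw [timeMean, norm_mul, norm_inv, Complex.norm_real, Real.norm_of_nonneg hT.le,
    inv_mul_le_iff₀ hT]
  rwa [sub_zero, abs_of_pos hT, mul_comm] at h

lemma tendsto_timeMean_of_norm_integral_le {g : ℝ → ℂ} {C : ℝ}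
    (hg : ∀ T : ℝ, 0 < T → ‖∫ t in (0 : ℝ)..T, g t‖ ≤ C) :
    Tendsto (timeMean g) atTop (𝓝 0) := by
  have hlim : Tendsto (fun T : ℝ => T⁻¹ * C) atTop (𝓝 0) := by
    simpa using tendsto_inv_atTop_zero.mul_const C
  refine squeeze_zero_norm' ?_ hlim
  filter_upwards [eventually_gt_atTop 0] with T hT
  rw [timeMean, norm_mul, norm_inv, Complex.norm_real, Real.norm_of_nonneg hT.le]
  exact mul_le_mul_of_nonneg_left (hg T hT) (by positivity)

/-- The additive character `t ↦ e^{iμt}` of `ℝ`. -/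
noncomputable def realChar (μ t : ℝ) : ℂ := Complex.exp ((μ * t : ℝ) * Complex.I)

lemma continuous_realChar (μ : ℝ) : Continuous (realChar μ) := by
  unfold realChar
  fun_prop

lemma norm_realChar (μ t : ℝ) : ‖realChar μ t‖ = 1 := Complex.norm_exp_ofReal_mul_I _

lemma realChar_add (μ ν t : ℝ) : realChar (μ + ν) t = realChar μ t * realChar ν t := by
  simp only [realChar, ← Complex.exp_add]
  congr 1
  push_cast
  ring

lemma conj_realChar (μ t : ℝ) : (starRingEnd ℂ) (realChar μ t) = realChar (-μ) t := by
  simp only [realChar, ← Complex.exp_conj, map_mul, Complex.conj_I, Complex.conj_ofReal]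
  congr 1
  push_cast
  ring

lemma tendsto_timeMean_realChar (μ : ℝ) :
    Tendsto (timeMean (realChar μ)) atTop (𝓝 (if μ = 0 then 1 else 0)) := by
  split_ifs with h
  · refine tendsto_const_nhds.congr' ?_
    filter_upwards [eventually_gt_atTop 0] with T hT
    have : (T : ℂ) ≠ 0 := by exact_mod_cast hT.ne'
    simp [timeMean, realChar, h, this]
  · have hμ : (μ : ℂ) * Complex.I ≠ 0 := by simp [h]
    refine tendsto_timeMean_of_norm_integral_le (C := 2 / |μ|) fun T _ => ?_
    have hintegral : ∫ t in (0 : ℝ)..T, realChar μ t =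
        (realChar μ T - realChar μ 0) / ((μ : ℂ) * Complex.I) := by
      have := integral_exp_mul_complex (a := 0) (b := T) hμ
      convert this using 3 <;> · simp only [realChar]; push_cast; ring_nf
    rw [hintegral, norm_div, norm_mul, Complex.norm_I, mul_one, Complex.norm_real, Real.norm_eq_abs]
    gcongr
    exact (norm_sub_le _ _).trans (by simp only [norm_realChar]; norm_num)

/-- The Riesz product `∏ (1 + Re (u_p p^{ikt}))`. -/
noncomputable def rieszProduct (u : ℕ → ℂ) (k : ℕ) (P : Finset ℕ) (t : ℝ) : ℝ :=
  ∏ p ∈ P, (1 + (u p * realChar (Real.log ((p ^ k : ℕ) : ℝ)) t).re)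

lemma rieszProduct_nonneg {u : ℕ → ℂ} (hu : ∀ p, ‖u p‖ = 1) (k : ℕ) (P : Finset ℕ) (t : ℝ) :
    0 ≤ rieszProduct u k P t := by
  refine Finset.prod_nonneg fun p _ => ?_
  have h := Complex.abs_re_le_norm (u p * realChar (Real.log ((p ^ k : ℕ) : ℝ)) t)
  rw [norm_mul, hu, norm_realChar, one_mul] at h
  linarith [(abs_le.mp h).1]

lemma continuous_rieszProduct (u : ℕ → ℂ) (k : ℕ) (P : Finset ℕ) :
    Continuous (rieszProduct u k P) := by
  unfold rieszProduct
  have := continuous_realChar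
  fun_prop

/-- `g` has the Bohr–Fourier coefficients of the Dirichlet series `∑ b n * n^{-it}` at all
logarithms of positive rationals. -/
def HasDirichletMeans (g : ℝ → ℂ) (b : ℕ → ℂ) : Prop :=
  ∀ m n : ℕ, 0 < m → 0 < n → Nat.Coprime m n →
    Tendsto (timeMean fun t => g t * realChar (Real.log m - Real.log n) t) atTop
      (𝓝 (if n = 1 then b m else 0))

lemma HasDirichletMeans.mul_rieszProduct {g : ℝ → ℂ} {b : ℕ → ℂ} (hg : Continuous g)
    (hb : ∀ m n : ℕ, Nat.Coprime m n → b (m * n) = b m * b n) (h : HasDirichletMeans g b)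
    (u : ℕ → ℂ) {k : ℕ} (hk : k ≠ 0) (P : Finset ℕ) (hP : ∀ p ∈ P, p.Prime) :
    ∀ m n : ℕ, 0 < m → 0 < n → Nat.Coprime m n →
      (∀ p ∈ P, Nat.Coprime p m ∧ Nat.Coprime p n) →
      Tendsto (timeMean fun t =>
        g t * rieszProduct u k P t * realChar (Real.log m - Real.log n) t) atTop
        (𝓝 (if n = 1 then b m * ∏ p ∈ P, (1 + u p * b (p ^ k) / 2) else 0)) := by
  induction P using Finset.induction_on with
  | empty =>
    intro m n hm hn hmn _
    simpa [rieszProduct] using h m n hm hn hmn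
  | insert q P hq ih =>
    intro m n hm hn hmn hcop
    have hqp : q.Prime := hP q (Finset.mem_insert_self _ _)
    have ih' := ih fun p hp => hP p (Finset.mem_insert_of_mem hp)
    obtain ⟨hqm, hqn⟩ := hcop q (Finset.mem_insert_self _ _)
    have hcop' : ∀ p ∈ P, Nat.Coprime p m ∧ Nat.Coprime p n := fun p hp =>
      hcop p (Finset.mem_insert_of_mem hp)
    have hpq : ∀ p ∈ P, Nat.Coprime p (q ^ k) := fun p hp =>
      Nat.Coprime.pow_right _ ((Nat.coprime_primes (hP p (Finset.mem_insert_of_mem hp)) hqp).2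
        fun e => hq (e ▸ hp))
    have hqk : 0 < q ^ k := pow_pos hqp.pos k
    have h0 := ih' m n hm hn hmn hcop'
    have h1 := ih' (m * q ^ k) n (by positivity) hn
      (Nat.Coprime.mul_left hmn (Nat.Coprime.pow_left k hqn))
      fun p hp => ⟨(hcop' p hp).1.mul_right (hpq p hp), (hcop' p hp).2⟩
    have h2 := ih' m (n * q ^ k) hm (by positivity)
      (Nat.Coprime.mul_right hmn (Nat.Coprime.pow_left k hqm).symm)
      fun p hp => ⟨(hcop' p hp).1, (hcop' p hp).2.mul_right (hpq p hp)⟩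
    have hne : n * q ^ k ≠ 1 := fun e =>
      (Nat.one_lt_pow hk hqp.one_lt).ne' (Nat.eq_one_of_mul_eq_one_left e)
    have hcont : ∀ μ : ℝ, Continuous fun t => g t * rieszProduct u k P t * realChar μ t :=
      fun μ => (hg.mul (Complex.continuous_ofReal.comp (continuous_rieszProduct u k P))).mul
        (continuous_realChar μ)
    have hcont' : ∀ (c : ℂ) (μ : ℝ),
        Continuous fun t => c * (g t * rieszProduct u k P t * realChar μ t) :=
      fun c μ => continuous_const.mul (hcont μ)
    have hsum := (h0.add (h1.const_mul (u q / 2))).add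
      (h2.const_mul ((starRingEnd ℂ) (u q) / 2))
    convert hsum using 1
    · ext T
      rw [← timeMean_const_mul, ← timeMean_const_mul,
        ← timeMean_add (hcont _) (hcont' _ _),
        ← timeMean_add ((hcont _).fun_add (hcont' _ _)) (hcont' _ _)]
      congr 1
      ext t
      have hm' : Real.log ((m * q ^ k : ℕ) : ℝ) - Real.log n =
          (Real.log m - Real.log n) + Real.log ((q ^ k : ℕ) : ℝ) := by
        rw [Nat.cast_mul, Real.log_mul (by positivity) (by positivity)]
        ring
      have hn' : Real.log m - Real.log ((n * q ^ k : ℕ) : ℝ) =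
          (Real.log m - Real.log n) + -Real.log ((q ^ k : ℕ) : ℝ) := by
        rw [Nat.cast_mul, Real.log_mul (by positivity) (by positivity)]
        ring
      have hre : ((u q * realChar (Real.log ((q ^ k : ℕ) : ℝ)) t).re : ℂ) =
          (u q * realChar (Real.log ((q ^ k : ℕ) : ℝ)) t +
            (starRingEnd ℂ) (u q) * realChar (-Real.log ((q ^ k : ℕ) : ℝ)) t) / 2 := by
        rw [Complex.re_eq_add_conj, map_mul, conj_realChar]
      rw [hm', hn', realChar_add, realChar_add, rieszProduct, Finset.prod_insert hq,
        ← rieszProduct, Complex.ofReal_mul, Complex.ofReal_add, hre, Complex.ofReal_one]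
      ring
    · rw [if_neg hne, Finset.prod_insert hq, hb m (q ^ k) (Nat.Coprime.pow_left k hqm).symm]
      congr 1
      split_ifs <;> ring

lemma hasDirichletMeans_one : HasDirichletMeans 1 fun n => if n = 1 then 1 else 0 := by
  intro m n hm hn hmn
  have h := tendsto_timeMean_realChar (Real.log m - Real.log n)
  simp only [Pi.one_apply, one_mul]
  convert h using 2
  have key : Real.log m - Real.log n = 0 ↔ m = n := by
    rw [sub_eq_zero]
    refine ⟨fun e => ?_, fun e => by rw [e]⟩
    exact_mod_cast Real.log_injOn_pos (Set.mem_Ioi.2 (by positivity : (0 : ℝ) < m))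
      (Set.mem_Ioi.2 (by positivity : (0 : ℝ) < n)) e
  simp only [key, ← ite_and]
  refine if_congr ⟨fun e => e.2.trans e.1.symm, ?_⟩ rfl rfl
  rintro rfl
  exact ⟨(Nat.coprime_self m).1 hmn, (Nat.coprime_self m).1 hmn⟩

/-- **Bohr's inequality** for multiplicative coefficients, by means of Riesz products. -/
lemma HasDirichletMeans.prod_one_add_le {g : ℝ → ℂ} {b : ℕ → ℂ} {C : ℝ} (hg : Continuous g)
    (hC : ∀ t, ‖g t‖ ≤ C) (hb1 : b 1 = 1)
    (hb : ∀ m n : ℕ, Nat.Coprime m n → b (m * n) = b m * b n) (h : HasDirichletMeans g b)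
    {k : ℕ} (hk : k ≠ 0) (P : Finset ℕ) (hP : ∀ p ∈ P, p.Prime) :
    ∏ p ∈ P, (1 + ‖b (p ^ k)‖ / 2) ≤ C := by
  have hphase : ∀ z : ℂ, ∃ v : ℂ, ‖v‖ = 1 ∧ v * z = (‖z‖ : ℂ) := fun z =>
    (eq_or_ne z 0).elim (fun hz => ⟨1, by simp [hz]⟩) fun hz => by
      have hz' : (‖z‖ : ℂ) ≠ 0 := by simpa using hz
      exact ⟨‖z‖ / z, by simp [hz], by field_simp⟩
  choose v hv hvz using hphase
  set u : ℕ → ℂ := fun p => v (b (p ^ k))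
  have hu : ∀ p, ‖u p‖ = 1 := fun p => hv _
  have hcop : ∀ p ∈ P, Nat.Coprime p 1 ∧ Nat.Coprime p 1 := by simp
  have h1 := h.mul_rieszProduct hg hb u hk P hP 1 1 one_pos one_pos (by simp) hcop
  have h2 := hasDirichletMeans_one.mul_rieszProduct continuous_one
    (fun m n _ => by by_cases hm : m = 1 <;> by_cases hn : n = 1 <;> simp [hm, hn]) u hk P hP
    1 1 one_pos one_pos (by simp) hcop
  have hprod : ∏ p ∈ P, (1 + u p * (if p ^ k = 1 then (1 : ℂ) else 0) / 2) = 1 :=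
    Finset.prod_eq_one fun p hp => by
      rw [if_neg (Nat.one_lt_pow hk (hP p hp).one_lt).ne']
      simp
  have hreal : ∏ p ∈ P, (1 + u p * b (p ^ k) / 2) =
      ((∏ p ∈ P, (1 + ‖b (p ^ k)‖ / 2) : ℝ) : ℂ) := by
    push_cast
    exact Finset.prod_congr rfl fun p _ => by rw [hvz]
  have hK : ∀ T : ℝ, timeMean (fun t => (rieszProduct u k P t : ℂ)) T =
      ((T⁻¹ * ∫ t in (0 : ℝ)..T, rieszProduct u k P t : ℝ) : ℂ) := fun T => by
    rw [timeMean, intervalIntegral.integral_ofReal]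
    push_cast
    rfl
  simp only [Nat.cast_one, Real.log_one, sub_self, if_true, hb1, one_mul, hreal, realChar,
    zero_mul, Complex.ofReal_zero, Complex.exp_zero, mul_one, Pi.one_apply, hprod] at h1 h2
  have h2' : Tendsto (fun T : ℝ => T⁻¹ * ∫ t in (0 : ℝ)..T, rieszProduct u k P t) atTop
      (𝓝 1) := by
    rw [funext hK] at h2
    simpa only [Function.comp_def, Complex.ofReal_re, Complex.one_re] using
      (Complex.continuous_re.tendsto 1).comp h2
  have hle := le_of_tendsto_of_tendsto h1.norm (h2'.const_mul C) <| by
    filter_upwards [eventually_gt_atTop 0] with T hT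
    rw [timeMean, norm_mul, norm_inv, Complex.norm_real, Real.norm_of_nonneg hT.le,
      mul_left_comm]
    refine mul_le_mul_of_nonneg_left ?_ (by positivity)
    rw [← intervalIntegral.integral_const_mul]
    refine intervalIntegral.norm_integral_le_of_norm_le hT.le (Eventually.of_forall fun t _ => ?_)
      ((continuous_const.mul (continuous_rieszProduct u k P)).intervalIntegrable _ _)
    rw [norm_mul, Complex.norm_real, Real.norm_of_nonneg (rieszProduct_nonneg hu k P t)]
    exact mul_le_mul_of_nonneg_right (hC t) (rieszProduct_nonneg hu k P t)
  rw [Complex.norm_real, mul_one] at hle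
  exact (Real.le_norm_self _).trans hle

lemma term_add_mul_I (a : ℕ → ℂ) (σ t : ℝ) (n : ℕ) :
    LSeries.term a (σ + t * Complex.I) n = LSeries.term a σ n * realChar (-Real.log n) t := by
  rcases eq_or_ne n 0 with rfl | hn
  · simp
  have hn' : (n : ℂ) ≠ 0 := by exact_mod_cast hn
  rw [LSeries.term_of_ne_zero hn, LSeries.term_of_ne_zero hn, Complex.cpow_add _ _ hn',
    ← div_div, div_eq_mul_inv _ ((n : ℂ) ^ ((t : ℂ) * Complex.I)), ← Complex.cpow_neg,
    Complex.cpow_def_of_ne_zero hn' (-(t * Complex.I)), realChar, ← Complex.natCast_log]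
  congr 2
  push_cast
  ring

lemma log_sub_log_sub_log_eq_zero_iff {m n l : ℕ} (hm : 0 < m) (hn : 0 < n) (hl : 0 < l)
    (hmn : Nat.Coprime m n) :
    Real.log m - Real.log n - Real.log l = 0 ↔ n = 1 ∧ l = m := by
  constructor
  · intro h
    have h' : Real.log m = Real.log ((n * l : ℕ) : ℝ) := by
      rw [Nat.cast_mul, Real.log_mul (by positivity) (by positivity)]
      linarith
    have h'' : m = n * l := by
      exact_mod_cast Real.log_injOn_pos (Set.mem_Ioi.2 (by positivity : (0 : ℝ) < m))
        (Set.mem_Ioi.2 (by positivity : (0 : ℝ) < (n * l : ℕ))) h'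
    have hn1 : n = 1 := Nat.eq_one_of_dvd_coprimes hmn (h'' ▸ dvd_mul_right n l) dvd_rfl
    exact ⟨hn1, by simp [h'', hn1]⟩
  · rintro ⟨rfl, rfl⟩
    simp

lemma timeMean_LSeries_mul_realChar {a : ℕ → ℂ} {σ : ℝ} (h : LSeriesSummable a σ) (μ T : ℝ) :
    timeMean (fun t => LSeries a (σ + t * Complex.I) * realChar μ t) T =
      ∑' l : ℕ, LSeries.term a σ l * timeMean (realChar (μ - Real.log l)) T := by
  let f : ℕ → C(ℝ, ℂ) := fun l =>
    ⟨fun t => LSeries.term a σ l * realChar (μ - Real.log l) t,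
      continuous_const.mul (continuous_realChar _)⟩
  have hf : Summable fun l : ℕ =>
      ‖(f l).restrict (⟨Set.uIcc 0 T, isCompact_uIcc⟩ : TopologicalSpace.Compacts ℝ)‖ := by
    refine Summable.of_nonneg_of_le (fun _ => norm_nonneg _) (fun l => ?_) h.norm
    refine (ContinuousMap.norm_le _ (norm_nonneg _)).2 fun t => ?_
    simp [f, norm_realChar]
  have hsum := (intervalIntegral.hasSum_intervalIntegral_of_summable_norm hf).tsum_eq
  have hfun : ∀ t : ℝ, LSeries a (σ + t * Complex.I) * realChar μ t = ∑' l, f l t := fun t => by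
    rw [LSeries, ← tsum_mul_right]
    refine tsum_congr fun l => ?_
    simp only [f, ContinuousMap.coe_mk]
    rw [term_add_mul_I, mul_assoc, ← realChar_add]
    ring_nf
  simp only [timeMean, hfun, ← hsum]
  rw [← tsum_mul_left]
  refine tsum_congr fun l => ?_
  simp only [f, ContinuousMap.coe_mk, intervalIntegral.integral_const_mul]
  ring

lemma hasDirichletMeans_LSeries {a : ℕ → ℂ} {σ : ℝ} (h : LSeriesSummable a σ) :
    HasDirichletMeans (fun t => LSeries a (σ + t * Complex.I)) (LSeries.term a σ) := by
  intro m n hm hn hmn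
  rw [funext (timeMean_LSeries_mul_realChar h (Real.log m - Real.log n))]
  have hlim : ∑' l : ℕ, LSeries.term a σ l *
      (if Real.log m - Real.log n - Real.log l = 0 then 1 else 0) =
      if n = 1 then LSeries.term a σ m else 0 := by
    rw [tsum_eq_single m]
    · simp only [log_sub_log_sub_log_eq_zero_iff hm hn hm hmn, and_true, mul_ite, mul_one,
        mul_zero]
    · intro l hlm
      rcases Nat.eq_zero_or_pos l with rfl | hl
      · simp
      · simp [log_sub_log_sub_log_eq_zero_iff hm hn hl hmn, hlm]
  rw [← hlim]
  refine tendsto_tsum_of_dominated_convergence h.norm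
    (fun l => (tendsto_timeMean_realChar _).const_mul _) ?_
  filter_upwards [eventually_gt_atTop 0] with T hT l
  rw [norm_mul]
  exact mul_le_of_le_one_right (norm_nonneg _)
    (norm_timeMean_le hT fun t => (norm_realChar _ t).le)

/-- Means of a bounded analytic function do not depend on the vertical line. -/
lemma tendsto_timeMean_sub {G : ℂ → ℂ} {σ τ C : ℝ} (hστ : σ ≤ τ)
    (hG : DifferentiableOn ℂ G {s : ℂ | σ ≤ s.re})
    (hC : ∀ s : ℂ, σ ≤ s.re → s.re ≤ τ → ‖G s‖ ≤ C) :
    Tendsto (timeMean fun t => G (τ + t * Complex.I) - G (σ + t * Complex.I)) atTop (𝓝 0) := by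
  have hcont : ∀ x : ℝ, σ ≤ x → Continuous fun t : ℝ => G (x + t * Complex.I) := fun x hx =>
    hG.continuousOn.comp_continuous (by fun_prop) (by simp [hx])
  refine tendsto_timeMean_of_norm_integral_le (C := 2 * (C * (τ - σ))) fun T _ => ?_
  have hrect := Complex.integral_boundary_rect_eq_zero_of_differentiableOn G
    (σ : ℂ) (τ + T * Complex.I) <| hG.mono fun s hs => by
      have := hs.1
      simp [Set.uIcc_of_le hστ] at this
      exact this.1
  have hhor : ∀ y : ℝ, ‖∫ x : ℝ in σ..τ, G (x + y * Complex.I)‖ ≤ C * (τ - σ) := fun y => by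
    have := intervalIntegral.norm_integral_le_of_norm_le_const
      (a := σ) (b := τ) (f := fun x : ℝ => G (x + y * Complex.I)) (C := C) fun x hx => by
        rw [Set.uIoc_of_le hστ] at hx
        exact hC _ (by simpa using hx.1.le) (by simpa using hx.2)
    rwa [abs_of_nonneg (sub_nonneg.2 hστ)] at this
  simp only [Complex.ofReal_re, Complex.ofReal_im, Complex.add_re, Complex.add_im,
    Complex.mul_re, Complex.mul_im, Complex.I_re, Complex.I_im, mul_zero, mul_one, sub_self,
    add_zero, zero_add, smul_eq_mul] at hrect
  have heq : Complex.I * (∫ t in (0 : ℝ)..T, (G (τ + t * Complex.I) - G (σ + t * Complex.I))) =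
      (∫ x : ℝ in σ..τ, G (x + T * Complex.I)) -
        ∫ x : ℝ in σ..τ, G (x + (0 : ℝ) * Complex.I) := by
    rw [intervalIntegral.integral_sub ((hcont τ hστ).intervalIntegrable _ _)
      ((hcont σ le_rfl).intervalIntegrable _ _)]
    linear_combination hrect
  calc ‖∫ t in (0 : ℝ)..T, (G (τ + t * Complex.I) - G (σ + t * Complex.I))‖
      = ‖Complex.I * ∫ t in (0 : ℝ)..T, (G (τ + t * Complex.I) - G (σ + t * Complex.I))‖ := by
        simp
    _ ≤ C * (τ - σ) + C * (τ - σ) := by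
        rw [heq]
        exact (norm_sub_le _ _).trans (add_le_add (hhor T) (hhor 0))
    _ = 2 * (C * (τ - σ)) := by ring

lemma term_eq_exp_mul_term {a : ℕ → ℂ} {m : ℕ} (hm : 0 < m) (σ τ : ℝ) :
    LSeries.term a σ m =
      Complex.exp (Real.log m * (τ - σ) : ℝ) * LSeries.term a τ m := by
  have hm' : (m : ℂ) ≠ 0 := by exact_mod_cast hm.ne'
  rw [LSeries.term_of_ne_zero hm.ne', LSeries.term_of_ne_zero hm.ne',
    div_eq_mul_inv, div_eq_mul_inv, ← Complex.cpow_neg, ← Complex.cpow_neg,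
    Complex.cpow_def_of_ne_zero hm', Complex.cpow_def_of_ne_zero hm', ← Complex.natCast_log,
    mul_left_comm, ← Complex.exp_add]
  congr 2
  push_cast
  ring

lemma HasDirichletMeans.shift {a : ℕ → ℂ} {F : ℂ → ℂ} {σ τ C : ℝ} (hστ : σ ≤ τ)
    (hF : DifferentiableOn ℂ F {s : ℂ | σ ≤ s.re}) (hC : ∀ s : ℂ, σ ≤ s.re → ‖F s‖ ≤ C)
    (h : HasDirichletMeans (fun t => F (τ + t * Complex.I)) (LSeries.term a τ)) :
    HasDirichletMeans (fun t => F (σ + t * Complex.I)) (LSeries.term a σ) := by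
  intro m n hm hn hmn
  set μ := Real.log m - Real.log n
  have hcont : ∀ x : ℝ, σ ≤ x → Continuous fun t : ℝ => F (x + t * Complex.I) := fun x hx =>
    hF.continuousOn.comp_continuous (by fun_prop) (by simp [hx])
  have hC0 : 0 ≤ C := (norm_nonneg _).trans (hC σ (by simp))
  have hsub := tendsto_timeMean_sub (G := fun s => F s * Complex.exp (μ * (s - σ)))
    (C := C * Real.exp (|μ| * (τ - σ))) hστ (hF.mul (by fun_prop)) fun s hs hs' => by
      rw [norm_mul, Complex.norm_exp]
      refine mul_le_mul (hC s hs) (Real.exp_le_exp.2 ?_) (Real.exp_pos _).le hC0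
      simp only [Complex.mul_re, Complex.ofReal_re, Complex.ofReal_im, zero_mul, sub_zero,
        Complex.sub_re]
      exact mul_le_mul (le_abs_self μ) (by linarith) (by linarith) (abs_nonneg _)
  have hτ := (h m n hm hn hmn).const_mul (Complex.exp (μ * (τ - σ) : ℝ))
  have hlim := hτ.add (hsub.const_mul (-1))
  convert hlim using 1
  · ext T
    rw [← timeMean_const_mul, ← timeMean_const_mul, ← timeMean_add]
    · congr 1
      ext t
      have e1 : Complex.exp (μ * ((τ + t * Complex.I : ℂ) - σ)) =
          Complex.exp (μ * (τ - σ) : ℝ) * realChar μ t := by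
        rw [realChar, ← Complex.exp_add]
        congr 1
        push_cast
        ring
      have e2 : Complex.exp (μ * ((σ + t * Complex.I : ℂ) - σ)) = realChar μ t := by
        rw [realChar]
        congr 1
        push_cast
        ring
      simp only [e1, e2]
      ring
    · exact continuous_const.mul ((hcont τ hστ).mul (continuous_realChar μ))
    · exact continuous_const.mul (((hcont τ hστ).mul (by fun_prop)).sub
        ((hcont σ le_rfl).mul (by fun_prop)))
  · congr 1
    split_ifs with hn1
    · rw [term_eq_exp_mul_term hm σ τ]
      simp [μ, hn1]
    · simp

lemma Finset.one_add_sum_le_prod_one_add_of_nonneg {ι : Type*} (s : Finset ι) {f : ι → ℝ}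
    (hf : ∀ i, 0 ≤ f i) : 1 + ∑ i ∈ s, f i ≤ ∏ i ∈ s, (1 + f i) := by
  classical
  induction s using Finset.induction_on with
  | empty => simp
  | insert j s hj ih =>
    rw [Finset.sum_insert hj, Finset.prod_insert hj]
    nlinarith [hf j, Finset.sum_nonneg fun i (_ : i ∈ s) => hf i]

/-- A nonnegative multiplicative function is summable as soon as it is summable over prime powers,
uniformly controlled exponent by exponent. -/
lemma summable_of_sum_prime_pow_le {c d : ℕ → ℝ} (hc : ∀ n, 0 ≤ c n) (hc0 : c 0 = 0)
    (hc1 : c 1 = 1) (hmul : ∀ m n : ℕ, Nat.Coprime m n → c (m * n) = c m * c n)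
    (hd : Summable d)
    (h : ∀ (k : ℕ) (P : Finset ℕ), (∀ p ∈ P, p.Prime) → ∑ p ∈ P, c (p ^ (k + 1)) ≤ d k) :
    Summable c := by
  have hsum1 : ∀ {p : ℕ}, p.Prime → Summable fun k : ℕ => c (p ^ (k + 1)) := fun {p} hp =>
    Summable.of_nonneg_of_le (fun _ => hc _)
      (fun k => by simpa using h k {p} (by simpa using hp)) hd
  have hsum : ∀ {p : ℕ}, p.Prime → Summable fun k : ℕ => c (p ^ k) := fun {p} hp =>
    (summable_nat_add_iff (f := fun k => c (p ^ k)) 1).1 (hsum1 hp)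
  have hprod : ∀ N : ℕ, ∏ p ∈ N.primesBelow, ∑' k, c (p ^ k) ≤ Real.exp (∑' k, d k) := fun N => by
    have hp : ∀ p ∈ N.primesBelow, p.Prime := fun p hp => Nat.prime_of_mem_primesBelow hp
    calc ∏ p ∈ N.primesBelow, ∑' k, c (p ^ k)
        = ∏ p ∈ N.primesBelow, (1 + ∑' k, c (p ^ (k + 1))) :=
          Finset.prod_congr rfl fun p hpN => by
            rw [(hsum (hp p hpN)).tsum_eq_zero_add, pow_zero, hc1]
      _ ≤ Real.exp (∑ p ∈ N.primesBelow, ∑' k, c (p ^ (k + 1))) :=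
          Real.prod_one_add_le_exp_sum _ fun p => tsum_nonneg fun k => hc _
      _ ≤ Real.exp (∑' k, d k) := by
          rw [← Summable.tsum_finsetSum fun p hpN => hsum1 (hp p hpN)]
          exact Real.exp_le_exp.2 (Summable.tsum_le_tsum (fun k => h k _ hp)
            (summable_sum fun p hpN => hsum1 (hp p hpN)) hd)
  refine summable_of_sum_range_le (c := Real.exp (∑' k, d k)) hc fun N => ?_
  obtain ⟨hs, hs'⟩ := EulerProduct.summable_and_hasSum_smoothNumbers_prod_primesBelow_tsum hc1
    (fun {m n} => hmul m n) (fun hp => (hsum hp).norm) N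
  have hind : Summable ((N.smoothNumbers).indicator c) :=
    summable_subtype_iff_indicator.1 hs.of_norm
  calc ∑ n ∈ Finset.range N, c n
      = ∑ n ∈ Finset.range N, (N.smoothNumbers).indicator c n :=
        Finset.sum_congr rfl fun n hn => by
          rcases Nat.eq_zero_or_pos n with rfl | hn0
          · rw [hc0, eq_comm, Set.indicator_apply_eq_zero]
            exact fun _ => hc0
          · rw [Set.indicator_of_mem
              (Nat.mem_smoothNumbers_of_lt hn0 (Finset.mem_range.1 hn))]
    _ ≤ ∑' n, (N.smoothNumbers).indicator c n :=
        hind.sum_le_tsum _ fun n _ => Set.indicator_nonneg (fun n _ => hc n) n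
    _ = ∏ p ∈ N.primesBelow, ∑' k, c (p ^ k) := by
        rw [← tsum_subtype, hs'.tsum_eq]
    _ ≤ Real.exp (∑' k, d k) := hprod N

lemma IsMultiplicativeFun.term_mul {a : ℕ → ℂ} (ha : IsMultiplicativeFun a) (σ : ℝ) (m n : ℕ)
    (hmn : Nat.Coprime m n) :
    LSeries.term a σ (m * n) = LSeries.term a σ m * LSeries.term a σ n := by
  rcases Nat.eq_zero_or_pos m with rfl | hm
  · simp
  rcases Nat.eq_zero_or_pos n with rfl | hn
  · simp
  rw [LSeries.term_of_ne_zero (by positivity), LSeries.term_of_ne_zero hm.ne',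
    LSeries.term_of_ne_zero hn.ne', ha.2 m n hm hn hmn, Nat.cast_mul,
    Complex.natCast_mul_natCast_cpow]
  ring

lemma IsMultiplicativeFun.term_one {a : ℕ → ℂ} (ha : IsMultiplicativeFun a) (σ : ℝ) :
    LSeries.term a σ 1 = 1 := by
  simp [LSeries.term_of_ne_zero, ha.1]

lemma dirichletPartial_eq_sum_term (a : ℕ → ℂ) (s : ℂ) (N : ℕ) :
    dirichletPartial a s N = ∑ n ∈ Finset.range N, LSeries.term a s (n + 1) := by
  refine Finset.sum_congr rfl fun n _ => ?_
  rw [LSeries.term_of_ne_zero n.succ_ne_zero]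
  push_cast
  rfl

lemma tendsto_dirichletPartial {a : ℕ → ℂ} {s : ℂ} (h : LSeriesSummable a s) :
    Tendsto (dirichletPartial a s) atTop (𝓝 (LSeries a s)) := by
  refine (h.LSeriesHasSum.tendsto_sum_nat.comp (tendsto_add_atTop_nat 1)).congr fun N => ?_
  simp [dirichletPartial_eq_sum_term, Finset.sum_range_succ']

lemma dirichletAbsConvergesAt_iff (a : ℕ → ℂ) (σ : ℝ) :
    DirichletAbsConvergesAt a σ ↔ LSeriesSummable a σ := by
  rw [LSeriesSummable, ← summable_norm_iff, ← summable_nat_add_iff 1, DirichletAbsConvergesAt]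
  refine summable_congr fun n => ?_
  rw [LSeries.norm_term_eq, if_neg n.succ_ne_zero]
  push_cast
  rfl

lemma LSeriesSummable_of_tendsto_dirichletPartial {a : ℕ → ℂ} {x : ℝ} {l : ℂ}
    (h : Tendsto (dirichletPartial a x) atTop (𝓝 l)) {s : ℂ} (hs : x + 1 < s.re) :
    LSeriesSummable a s := by
  obtain ⟨B, hB⟩ := (Metric.isBounded_range_of_tendsto _ h).exists_norm_le
  refine LSeriesSummable_of_le_const_mul_rpow hs ⟨B + B, fun n hn => ?_⟩
  obtain ⟨N, rfl⟩ := Nat.exists_eq_succ_of_ne_zero hn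
  have hterm : LSeries.term a x (N + 1) =
      dirichletPartial a x (N + 1) - dirichletPartial a x N := by
    simp [dirichletPartial_eq_sum_term, Finset.sum_range_succ]
  have hle : ‖LSeries.term a x (N + 1)‖ ≤ B + B := by
    rw [hterm]
    exact (norm_sub_le _ _).trans
      (add_le_add (hB _ (Set.mem_range_self _)) (hB _ (Set.mem_range_self _)))
  rw [LSeries.norm_term_eq, if_neg hn, Complex.ofReal_re,
    div_le_iff₀ (Real.rpow_pos_of_pos (by positivity) _)] at hle
  simpa using hle

lemma LSeriesSummable.norm_LSeries_le {a : ℕ → ℂ} {σ : ℝ} (h : LSeriesSummable a σ) {s : ℂ}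
    (hs : σ ≤ s.re) : ‖LSeries a s‖ ≤ ∑' n, ‖LSeries.term a σ n‖ :=
  tsum_of_norm_bounded h.norm.hasSum fun n =>
    LSeries.norm_term_le_of_re_le_re a (by simpa using hs) n

lemma LSeriesSummable.extendsBoundedlyPast {a : ℕ → ℂ} {σ : ℝ} (h : LSeriesSummable a σ) :
    ExtendsBoundedlyPast a σ := by
  refine ⟨LSeries a, (LSeries_differentiableOn a).mono fun s hs => ?_, ⟨σ, le_rfl, fun s hs => ?_⟩,
    fun ε hε => ⟨_, fun s hs => h.norm_LSeries_le (by linarith)⟩⟩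
  · refine h.abscissaOfAbsConv_le.trans_lt ?_
    rw [Complex.ofReal_re]
    exact_mod_cast hs
  · exact tendsto_dirichletPartial (h.of_re_le_re (by simpa using hs.le))

/-- For multiplicative coefficients, boundedness on half-planes forces absolute convergence. -/
lemma IsMultiplicativeFun.lseriesSummable_of_extendsBoundedlyPast {a : ℕ → ℂ} {σ₀ σ : ℝ}
    (ha : IsMultiplicativeFun a) (hext : ExtendsBoundedlyPast a σ₀) (hσ : σ₀ < σ) :
    LSeriesSummable a σ := by
  obtain ⟨F, hF, ⟨σ₁, hσ₁, hlim⟩, hbdd⟩ := hext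
  obtain ⟨ρ, hρ₀, hρ⟩ := exists_between hσ
  obtain ⟨C, hC⟩ := hbdd (ρ - σ₀) (sub_pos.2 hρ₀)
  replace hC : ∀ s : ℂ, ρ ≤ s.re → ‖F s‖ ≤ C := fun s hs => hC s (by linarith)
  replace hF : DifferentiableOn ℂ F {s : ℂ | ρ ≤ s.re} := hF.mono fun s hs =>
    hρ₀.trans_le hs
  set τ : ℝ := max ρ (σ₁ + 3)
  have hτ : σ₁ + 3 ≤ τ := le_max_right _ _
  have habs : ∀ s : ℂ, s.re = τ → LSeriesSummable a s := fun s hs =>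
    LSeriesSummable_of_tendsto_dirichletPartial (x := σ₁ + 1) (hlim _ (by simp)) (by linarith)
  have hFτ : (fun t : ℝ => F (τ + t * Complex.I)) =
      fun t : ℝ => LSeries a (τ + t * Complex.I) := by
    ext t
    exact tendsto_nhds_unique (hlim _ (by simp; linarith))
      (tendsto_dirichletPartial (habs _ (by simp)))
  have hmeans : HasDirichletMeans (fun t => F (ρ + t * Complex.I)) (LSeries.term a ρ) := by
    refine HasDirichletMeans.shift (τ := τ) (le_max_left _ _) hF hC ?_
    rw [hFτ]
    exact hasDirichletMeans_LSeries (habs _ (by simp))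
  have hcont : Continuous fun t : ℝ => F (ρ + t * Complex.I) :=
    hF.continuousOn.comp_continuous (by fun_prop) (by simp)
  have hbohr : ∀ (k : ℕ) (P : Finset ℕ), (∀ p ∈ P, p.Prime) →
      ∑ p ∈ P, ‖LSeries.term a ρ (p ^ (k + 1))‖ ≤ 2 * C := fun k P hP => by
    have h1 := hmeans.prod_one_add_le hcont (fun t => hC _ (by simp)) (ha.term_one ρ)
      (ha.term_mul ρ) k.succ_ne_zero P hP
    have h2 := Finset.one_add_sum_le_prod_one_add_of_nonneg P
      (f := fun p => ‖LSeries.term a ρ (p ^ (k + 1))‖ / 2) fun p => by positivity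
    rw [← Finset.sum_div] at h2
    linarith
  set r : ℝ := 2 ^ (ρ - σ)
  have hr0 : 0 ≤ r := by positivity
  have hr1 : r < 1 := Real.rpow_lt_one_of_one_lt_of_neg one_lt_two (by linarith)
  refine Summable.of_norm (summable_of_sum_prime_pow_le (d := fun k => r ^ (k + 1) * (2 * C))
    (fun _ => norm_nonneg _) (by simp) (by rw [ha.term_one, norm_one])
    (fun m n hmn => by rw [ha.term_mul σ m n hmn, norm_mul])
    (((summable_geometric_of_lt_one hr0 hr1).comp_injective
      (add_left_injective 1)).mul_right _) fun k P hP => ?_)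
  refine le_trans ?_ (mul_le_mul_of_nonneg_left (hbohr k P hP) (by positivity))
  rw [Finset.mul_sum]
  refine Finset.sum_le_sum fun p hp => ?_
  have hp2 : (2 : ℝ) ≤ p := by exact_mod_cast (hP p hp).two_le
  have hpk : 0 < p ^ (k + 1) := pow_pos (hP p hp).pos _
  rw [term_eq_exp_mul_term hpk σ ρ, norm_mul, ← Complex.ofReal_exp, Complex.norm_real,
    Real.norm_of_nonneg (Real.exp_pos _).le, ← Real.rpow_def_of_pos (by exact_mod_cast hpk)]
  refine mul_le_mul_of_nonneg_right ?_ (norm_nonneg _)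
  rw [Nat.cast_pow, ← Real.rpow_natCast, ← Real.rpow_mul (by positivity), mul_comm,
    Real.rpow_mul (by positivity), Real.rpow_natCast]
  exact pow_le_pow_left₀ (by positivity)
    (Real.rpow_le_rpow_of_nonpos two_pos hp2 (by linarith)) _

/-- If `a` is multiplicative, the Dirichlet series converges somewhere, and
`σ₀` is the infimum of abscissas past which `f` has a bounded analytic continuation,
then `σ_a(f) = σ₀`. -/
theorem multiplicative_bohr_corollary (a : ℕ → ℂ) (σ₀ : ℝ)
    (ha : IsMultiplicativeFun a) (hconv : ∃ σ : ℝ, DirichletConvergesAt a σ)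
    (hext : ExtendsBoundedlyPast a σ₀)
    (hmin : ∀ σ' : ℝ, ExtendsBoundedlyPast a σ' → σ₀ ≤ σ') :
    sigmaA a = σ₀ := by
  have hlower : ∀ σ ∈ {σ : ℝ | DirichletAbsConvergesAt a σ}, σ₀ ≤ σ := fun σ hσ =>
    hmin σ ((dirichletAbsConvergesAt_iff a σ).1 hσ).extendsBoundedlyPast
  have hupper : ∀ σ : ℝ, σ₀ < σ → σ ∈ {σ : ℝ | DirichletAbsConvergesAt a σ} := fun σ hσ =>
    (dirichletAbsConvergesAt_iff a σ).2 (ha.lseriesSummable_of_extendsBoundedlyPast hext hσ)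
  refine csInf_eq_of_forall_ge_of_forall_gt_exists_lt ⟨σ₀ + 1, hupper _ (by linarith)⟩ hlower
    fun w hw => ?_
  obtain ⟨v, hv, hvw⟩ := exists_between hw
  exact ⟨v, hupper v hv, hvw⟩
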